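/- Let (Ω, μ) be a probability space and let X = (X_A, X_B, X_C) : Ω → ℝ^{n_A} × ℝ^{n_B} × ℝ^{n_C} be a random vector whose joint law is multivariate Gaussian with positive definite covariance matrix Σ. Then X_A and X_B are conditionally independent given the σ-algebra generated by X_C if and only if the (n_A + n_C) × (n_B + n_C) cross-covariance matrix between (X_A, X_C) and (X_B, X_C), i.e. the block matrix [[Σ_{A,B}, Σ_{A,C}], [Σ_{C,B}, Σ_{C,C}]], has rank equal to n_C. -/

import Mathlib

open MeasureTheory ProbabilityTheory

/-- The cross-covariance matrix of two random vectors: entry `(i, j)` is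
`Cov(X_i, Y_j) = E[X_i Y_j] − E[X_i] E[Y_j]`. -/
noncomputable def crossCov {Ω : Type*} [MeasurableSpace Ω] (μ : Measure Ω)
    {p q : ℕ} (X : Ω → Fin p → ℝ) (Y : Ω → Fin q → ℝ) :
    Matrix (Fin p) (Fin q) ℝ :=
  Matrix.of fun i j =>
    (∫ ω, X ω i * Y ω j ∂μ) - (∫ ω, X ω i ∂μ) * (∫ ω, Y ω j ∂μ)

theorem Submodule.finrank_prod_eq {K V W : Type*} [Field K] [AddCommGroup V] [Module K V]
    [AddCommGroup W] [Module K W] [FiniteDimensional K V] [FiniteDimensional K W]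
    (p : Submodule K V) (q : Submodule K W) :
    Module.finrank K (p.prod q) = Module.finrank K p + Module.finrank K q := by
  let e : p.prod q ≃ₗ[K] p × q :=
    { toFun := fun x => (⟨x.1.1, x.2.1⟩, ⟨x.1.2, x.2.2⟩)
      invFun := fun x => ⟨(x.1, x.2), x.1.2, x.2.2⟩
      map_add' := fun _ _ => rfl
      map_smul' := fun _ _ => rfl }
  rw [e.finrank_eq, Module.finrank_prod]

namespace Matrix

variable {K l m n o : Type*} [Field K] [Fintype m] [Fintype n]

theorem rank_fromBlocks_zero₁₂_zero₂₁ [Fintype l] [Fintype o] (A : Matrix l m K)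
    (D : Matrix n o K) :
    (fromBlocks A 0 0 D).rank = A.rank + D.rank := by
  have h : (fromBlocks A 0 0 D).mulVecLin =
      (LinearEquiv.sumArrowLequivProdArrow l n K K).symm.toLinearMap ∘ₗ
        (A.mulVecLin.prodMap D.mulVecLin) ∘ₗ
        (LinearEquiv.sumArrowLequivProdArrow m o K K).toLinearMap := by
    refine LinearMap.ext fun x => ?_
    ext i
    cases i <;> simp [fromBlocks_mulVec] <;> rfl
  rw [rank, h, ← LinearMap.comp_assoc, LinearEquiv.range_comp, LinearMap.range_comp,
    LinearEquiv.finrank_map_eq, LinearMap.range_prodMap, Submodule.finrank_prod_eq]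
  rfl

theorem rank_eq_zero_iff {A : Matrix l n K} : A.rank = 0 ↔ A = 0 := by
  classical
  rw [rank, Submodule.finrank_eq_zero, LinearMap.range_eq_bot, ← toLin'_apply',
    LinearEquiv.map_eq_zero_iff]

theorem rank_fromBlocks_eq_card_iff [Fintype l] [DecidableEq n] (A : Matrix l m K)
    (B : Matrix l n K)
    (C : Matrix n m K) {D : Matrix n n K} (hD : IsUnit D) :
    (fromBlocks A B C D).rank = Fintype.card n ↔ A - B * D⁻¹ * C = 0 := by
  classical
  let := hD.invertible
  rw [fromBlocks_eq_of_invertible₂₂, rank_mul_eq_left_of_isUnit_det _ _ (by simp),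
    rank_mul_eq_right_of_isUnit_det _ _ (by simp), rank_fromBlocks_zero₁₂_zero₂₁,
    rank_of_isUnit D hD, invOf_eq_nonsing_inv, Nat.add_eq_right, rank_eq_zero_iff]

end Matrix

namespace ProbabilityTheory

section Shift

variable {Ω α β γ : Type*} [MeasurableSpace Ω] [MeasurableSpace α] [MeasurableSpace β]
  [MeasurableSpace γ] [AddGroup β] [MeasurableAdd₂ β] {μ : Measure Ω}

/-- The kernel sending `a` to the law of `R + T a`, where `R` has law `ν`. -/
noncomputable def shiftKernel (ν : Measure β) (T : α → β) : Kernel α β :=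
  (Kernel.id ×ₖ Kernel.const α ν).map fun p => p.2 + T p.1

instance (ν : Measure β) [IsFiniteMeasure ν] (T : α → β) : IsFiniteKernel (shiftKernel ν T) := by
  unfold shiftKernel; infer_instance

theorem shiftKernel_apply (ν : Measure β) [SFinite ν] {T : α → β} (hT : Measurable T) (a : α) :
    shiftKernel ν T a = ν.map (· + T a) := by
  rw [shiftKernel, Kernel.map_apply _ (by fun_prop), Kernel.prod_apply, Kernel.id_apply,
    Kernel.const_apply, Measure.dirac_prod, Measure.map_map (by fun_prop) (by fun_prop)]
  rfl

theorem prodMkRight_shiftKernel (ν : Measure β) [SFinite ν] {T : α → β} (hT : Measurable T) :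
    (shiftKernel ν T).prodMkRight γ = shiftKernel ν (fun p : α × γ => T p.1) := by
  ext1 p
  rw [Kernel.prodMkRight_apply, shiftKernel_apply _ hT, shiftKernel_apply _ (by fun_prop)]

theorem compProd_shiftKernel (ρ : Measure α) [SFinite ρ] (ν : Measure β) [IsFiniteMeasure ν]
    {T : α → β} (hT : Measurable T) :
    ρ ⊗ₘ shiftKernel ν T = (ρ.prod ν).map fun p => (p.1, p.2 + T p.1) := by
  ext s hs
  rw [Measure.compProd_apply hs, Measure.map_apply (by fun_prop) hs,
    Measure.prod_apply (measurableSet_preimage (by fun_prop) hs)]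
  refine lintegral_congr fun a => ?_
  rw [shiftKernel_apply _ hT, Measure.map_apply (by fun_prop) (measurable_prodMk_left hs)]
  rfl

theorem map_prodMk_add_eq_compProd_shiftKernel_iff [MeasurableSub₂ β]
    [IsFiniteMeasure μ] {k : Ω → α} {R : Ω → β}
    {T : α → β} (hk : Measurable k) (hR : Measurable R) (hT : Measurable T) :
    μ.map (fun ω => (k ω, R ω + T (k ω))) = μ.map k ⊗ₘ shiftKernel (μ.map R) T ↔
      IndepFun k R μ := by
  let e : α × β ≃ᵐ α × β :=
    { toFun := fun p => (p.1, p.2 + T p.1)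
      invFun := fun p => (p.1, p.2 - T p.1)
      left_inv := fun p => by simp
      right_inv := fun p => by simp
      measurable_toFun := by simp only [Equiv.coe_fn_mk]; fun_prop
      measurable_invFun := by simp only [Equiv.coe_fn_symm_mk]; fun_prop }
  have h : μ.map (fun ω => (k ω, R ω + T (k ω))) = (μ.map fun ω => (k ω, R ω)).map e := by
    rw [Measure.map_map e.measurable (by fun_prop)]
    rfl
  rw [compProd_shiftKernel _ _ hT, h,
    indepFun_iff_map_prod_eq_prod_map_map hk.aemeasurable hR.aemeasurable]
  exact e.map_measurableEquiv_injective.eq_iff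

/-- If `f = R + T k` with `R` independent of `k`, then `g` and `f` are conditionally independent
given `k` if and only if `R` is independent of the pair `(k, g)`. -/
theorem condIndepFun_add_comp_iff_indepFun [MeasurableSub₂ β] [StandardBorelSpace Ω]
    [StandardBorelSpace β] [StandardBorelSpace γ] [Nonempty γ] [IsFiniteMeasure μ]
    {k : Ω → α} {g : Ω → γ} {R : Ω → β}
    {T : α → β} (hk : Measurable k) (hg : Measurable g) (hR : Measurable R) (hT : Measurable T)
    (hind : IndepFun k R μ) :
    CondIndepFun (MeasurableSpace.comap k inferInstance) hk.comap_le g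
        (fun ω => R ω + T (k ω)) μ ↔
      IndepFun (fun ω => (k ω, g ω)) R μ := by
  have hf : Measurable fun ω => R ω + T (k ω) := by fun_prop
  have hcond : condDistrib (fun ω => R ω + T (k ω)) k μ =ᵐ[μ.map k] shiftKernel (μ.map R) T :=
    (condDistrib_ae_eq_iff_measure_eq_compProd k hf.aemeasurable _).2
      ((map_prodMk_add_eq_compProd_shiftKernel_iff hk hR hT).2 hind)
  have hcond' : (condDistrib (fun ω => R ω + T (k ω)) k μ).prodMkRight γ
      =ᵐ[μ.map fun ω => (k ω, g ω)] shiftKernel (μ.map R) fun p => T p.1 := by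
    have hfst : μ.map k = (μ.map fun ω => (k ω, g ω)).map Prod.fst := by
      rw [Measure.map_map measurable_fst (by fun_prop)]
      rfl
    rw [hfst] at hcond
    rw [← prodMkRight_shiftKernel _ hT]
    exact ae_of_ae_map measurable_fst.aemeasurable hcond
  rw [condIndepFun_iff_condDistrib_prod_ae_eq_prodMkRight hf hg hk,
    ← map_prodMk_add_eq_compProd_shiftKernel_iff (T := fun p => T p.1) (hk.prodMk hg) hR
      (by fun_prop),
    ← condDistrib_ae_eq_iff_measure_eq_compProd _ hf.aemeasurable]
  exact ⟨fun h => h.trans hcond', fun h => h.trans hcond'.symm⟩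

end Shift

end ProbabilityTheory

section CrossCov

open Matrix

variable {Ω : Type*} [MeasurableSpace Ω] {μ : Measure Ω} {p q r : ℕ}
  {X : Ω → Fin p → ℝ} {Y : Ω → Fin q → ℝ} {Z : Ω → Fin r → ℝ}

theorem transpose_crossCov (X : Ω → Fin p → ℝ) (Y : Ω → Fin q → ℝ) :
    (crossCov μ X Y)ᵀ = crossCov μ Y X := by
  ext i j
  simp [crossCov, mul_comm]

theorem crossCov_apply_eq_covariance [IsProbabilityMeasure μ] {i : Fin p} {j : Fin q}
    (hX : MemLp (fun ω => X ω i) 2 μ) (hY : MemLp (fun ω => Y ω j) 2 μ) :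
    crossCov μ X Y i j = cov[fun ω => X ω i, fun ω => Y ω j; μ] := by
  rw [covariance_eq_sub hX hY]
  rfl

theorem crossCov_sub_mulVec [IsProbabilityMeasure μ] (hX : ∀ i, MemLp (fun ω => X ω i) 2 μ)
    (hY : ∀ i, MemLp (fun ω => Y ω i) 2 μ) (hZ : ∀ i, MemLp (fun ω => Z ω i) 2 μ)
    (M : Matrix (Fin q) (Fin r) ℝ) :
    crossCov μ X (fun ω => Y ω - M *ᵥ Z ω) = crossCov μ X Y - crossCov μ X Z * Mᵀ := by
  ext i j
  have hMZ (k : Fin r) : MemLp (fun ω => M j k * Z ω k) 2 μ := (hZ k).const_mul _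
  have hsum : MemLp (fun ω => ∑ k, M j k * Z ω k) 2 μ := memLp_finsetSum _ fun k _ => hMZ k
  rw [crossCov_apply_eq_covariance (hX i) ((hY j).sub hsum), Matrix.sub_apply, mul_apply,
    crossCov_apply_eq_covariance (hX i) (hY j)]
  refine (covariance_fun_sub_right (hX i) (hY j) hsum).trans ?_
  rw [covariance_fun_sum_right hMZ (hX i)]
  congr 1
  refine Finset.sum_congr rfl fun k _ => ?_
  rw [covariance_const_mul_right, crossCov_apply_eq_covariance (hX i) (hZ k), mul_comm]
  rfl

theorem crossCov_eq_zero_of_indepFun [IsProbabilityMeasure μ]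
    (hX : ∀ i, MemLp (fun ω => X ω i) 2 μ) (hY : ∀ i, MemLp (fun ω => Y ω i) 2 μ)
    (h : IndepFun X Y μ) : crossCov μ X Y = 0 := by
  ext i j
  rw [crossCov_apply_eq_covariance (hX i) (hY j)]
  exact (h.comp (measurable_pi_apply i) (measurable_pi_apply j)).covariance_eq_zero (hX i) (hY j)

/-- If `((Z, X), Y)` is jointly Gaussian and `Y` is uncorrelated with both `Z` and `X`, then it is
independent of `(Z, X)`. -/
theorem ProbabilityTheory.HasGaussianLaw.indepFun_prodMk_of_crossCov_eq_zero
    (h : HasGaussianLaw (fun ω => (Sum.elim (Z ω) (X ω), Y ω)) μ)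
    (hZY : crossCov μ Z Y = 0) (hXY : crossCov μ X Y = 0) :
    IndepFun (fun ω => (Z ω, X ω)) Y μ := by
  have := h.isProbabilityMeasure
  have hY (j : Fin q) : MemLp (fun ω => Y ω j) 2 μ := (h.snd.eval j).memLp_two
  have hZX (i : Fin r ⊕ Fin p) : MemLp (fun ω => Sum.elim (Z ω) (X ω) i) 2 μ :=
    (h.fst.eval i).memLp_two
  have hind : IndepFun (fun ω => Sum.elim (Z ω) (X ω)) Y μ := by
    refine HasGaussianLaw.indepFun_of_covariance_eval
      (X := fun i ω => Sum.elim (Z ω) (X ω) i) (Y := fun j ω => Y ω j) h ?_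
    rintro (i | i) j
    · exact (crossCov_apply_eq_covariance (hZX (.inl i)) (hY j)).symm.trans (congrFun₂ hZY i j)
    · exact (crossCov_apply_eq_covariance (hZX (.inr i)) (hY j)).symm.trans (congrFun₂ hXY i j)
  exact hind.comp (φ := fun v => (fun i => v (.inl i), fun i => v (.inr i))) (by fun_prop)
    measurable_id

/-- For a jointly Gaussian vector `(X, Y, Z)`, conditional independence of `X` and `Y` given `Z`
amounts to the vanishing of the Schur complement of `Cov(Z, Z)`. -/
theorem ProbabilityTheory.HasGaussianLaw.condIndepFun_iff_crossCov_sub_eq_zero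
    [StandardBorelSpace Ω] [IsFiniteMeasure μ]
    (h : HasGaussianLaw (fun ω => Sum.elim (X ω) (Sum.elim (Y ω) (Z ω))) μ)
    (hXm : Measurable X) (hYm : Measurable Y) (hZm : Measurable Z)
    (hZ : IsUnit (crossCov μ Z Z)) :
    CondIndepFun (MeasurableSpace.comap Z inferInstance) hZm.comap_le X Y μ ↔
      crossCov μ X Y - crossCov μ X Z * (crossCov μ Z Z)⁻¹ * crossCov μ Z Y = 0 := by
  have := h.isProbabilityMeasure
  have hX2 (i : Fin p) : MemLp (fun ω => X ω i) 2 μ := (h.eval (.inl i)).memLp_two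
  have hY2 (i : Fin q) : MemLp (fun ω => Y ω i) 2 μ := (h.eval (.inr (.inl i))).memLp_two
  have hZ2 (i : Fin r) : MemLp (fun ω => Z ω i) 2 μ := (h.eval (.inr (.inr i))).memLp_two
  set M := crossCov μ Y Z * (crossCov μ Z Z)⁻¹ with hM
  have hMT : Mᵀ = (crossCov μ Z Z)⁻¹ * crossCov μ Z Y := by
    rw [hM, transpose_mul, transpose_nonsing_inv, transpose_crossCov, transpose_crossCov]
  have hZR : crossCov μ Z (fun ω => Y ω - M *ᵥ Z ω) = 0 := by
    rw [crossCov_sub_mulVec hZ2 hY2 hZ2, hMT,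
      mul_nonsing_inv_cancel_left _ _ ((isUnit_iff_isUnit_det _).1 hZ), sub_self]
  have hXR : crossCov μ X (fun ω => Y ω - M *ᵥ Z ω) =
      crossCov μ X Y - crossCov μ X Z * (crossCov μ Z Z)⁻¹ * crossCov μ Z Y := by
    rw [crossCov_sub_mulVec hX2 hY2 hZ2, hMT, Matrix.mul_assoc]
  have hmul : Measurable fun z : Fin r → ℝ => M *ᵥ z :=
    (Continuous.matrix_mulVec continuous_const continuous_id).measurable
  have hRm : Measurable fun ω => Y ω - M *ᵥ Z ω := hYm.sub (hmul.comp hZm)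
  let L : (Fin p ⊕ Fin q ⊕ Fin r → ℝ) →ₗ[ℝ] (Fin r ⊕ Fin p → ℝ) × (Fin q → ℝ) :=
    (LinearMap.funLeft ℝ ℝ (Sum.elim (.inr ∘ .inr) .inl)).prod
      (LinearMap.funLeft ℝ ℝ (.inr ∘ .inl) - M.mulVecLin ∘ₗ LinearMap.funLeft ℝ ℝ (.inr ∘ .inr))
  have hL : HasGaussianLaw (fun ω => (Sum.elim (Z ω) (X ω), Y ω - M *ᵥ Z ω)) μ := by
    have hcomp : (fun ω => (Sum.elim (Z ω) (X ω), Y ω - M *ᵥ Z ω)) =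
        fun ω => L.toContinuousLinearMap (Sum.elim (X ω) (Sum.elim (Y ω) (Z ω))) := by
      funext ω
      refine Prod.ext (funext ?_) rfl
      rintro (i | i) <;> rfl
    rw [hcomp]
    exact h.map_fun L.toContinuousLinearMap
  have hR2 (i : Fin q) : MemLp (fun ω => (Y ω - M *ᵥ Z ω) i) 2 μ := (hL.snd.eval i).memLp_two
  have hZind : IndepFun Z (fun ω => Y ω - M *ᵥ Z ω) μ := by
    have hLZ : HasGaussianLaw (fun ω => (Z ω, Y ω - M *ᵥ Z ω)) μ :=
      hL.map_fun ((LinearMap.funLeft ℝ ℝ Sum.inl).prodMap LinearMap.id).toContinuousLinearMap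
    refine HasGaussianLaw.indepFun_of_covariance_eval
      (X := fun i ω => Z ω i) (Y := fun j ω => (Y ω - M *ᵥ Z ω) j) hLZ fun i j => ?_
    rw [← crossCov_apply_eq_covariance (hZ2 i) (hR2 j), hZR, Matrix.zero_apply]
  have key := condIndepFun_add_comp_iff_indepFun hZm hXm hRm hmul hZind
  simp only [sub_add_cancel] at key
  rw [key, ← hXR]
  exact ⟨fun hind => crossCov_eq_zero_of_indepFun hX2 hR2 (hind.comp measurable_snd measurable_id),
    hL.indepFun_prodMk_of_crossCov_eq_zero hZR⟩

end CrossCov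

/-- For a jointly Gaussian random vector `X = (X_A, X_B, X_C)` with positive definite
covariance matrix, `X_A` and `X_B` are conditionally independent given the σ-algebra
generated by `X_C` if and only if the block cross-covariance matrix
`[[Σ_{A,B}, Σ_{A,C}], [Σ_{C,B}, Σ_{C,C}]]` between `(X_A, X_C)` and `(X_B, X_C)` has
rank `n_C`. Gaussianity of the joint law is expressed by requiring that every linear
functional of `X` has a Gaussian law on `ℝ`. -/
theorem condIndep_iff_rank_block_crossCov_eq_of_gaussian
    {Ω : Type*} [MeasurableSpace Ω] [StandardBorelSpace Ω] [Nonempty Ω]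
    (μ : Measure Ω) [IsProbabilityMeasure μ]
    {nA nB nC : ℕ}
    (XA : Ω → Fin nA → ℝ) (XB : Ω → Fin nB → ℝ) (XC : Ω → Fin nC → ℝ)
    (hXA : Measurable XA) (hXB : Measurable XB) (hXC : Measurable XC)
    (hGauss : ∀ L : ((Fin nA ⊕ Fin nB ⊕ Fin nC) → ℝ) →ₗ[ℝ] ℝ,
      ∃ (mL : ℝ) (vL : NNReal),
        Measure.map (fun ω => L (Sum.elim (XA ω) (Sum.elim (XB ω) (XC ω)))) μ
          = gaussianReal mL vL)
    (hSigma : (Matrix.of fun i j : Fin nA ⊕ Fin nB ⊕ Fin nC =>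
        (∫ ω, Sum.elim (XA ω) (Sum.elim (XB ω) (XC ω)) i
            * Sum.elim (XA ω) (Sum.elim (XB ω) (XC ω)) j ∂μ)
          - (∫ ω, Sum.elim (XA ω) (Sum.elim (XB ω) (XC ω)) i ∂μ)
            * (∫ ω, Sum.elim (XA ω) (Sum.elim (XB ω) (XC ω)) j ∂μ)).PosDef) :
    CondIndepFun (MeasurableSpace.comap XC inferInstance) hXC.comap_le XA XB μ ↔
      (Matrix.fromBlocks (crossCov μ XA XB) (crossCov μ XA XC)
        (crossCov μ XC XB) (crossCov μ XC XC)).rank = nC := by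
  have hG : HasGaussianLaw (fun ω => Sum.elim (XA ω) (Sum.elim (XB ω) (XC ω))) μ := by
    refine ⟨isGaussian_of_map_eq_gaussianReal fun L => ?_⟩
    obtain ⟨m, v, hL⟩ := hGauss L.toLinearMap
    refine ⟨m, v, ?_⟩
    have hm : Measurable fun ω => Sum.elim (XA ω) (Sum.elim (XB ω) (XC ω)) := by
      refine measurable_pi_iff.2 ?_
      rintro (i | i | i) <;> simp only [Sum.elim_inl, Sum.elim_inr] <;> fun_prop
    rw [← hL, Measure.map_map (by fun_prop) hm]
    rfl
  have hCC : IsUnit (crossCov μ XC XC) :=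
    (hSigma.submatrix (Sum.inr_injective.comp Sum.inr_injective)).isUnit
  rw [hG.condIndepFun_iff_crossCov_sub_eq_zero hXA hXB hXC hCC,
    ← Matrix.rank_fromBlocks_eq_card_iff _ _ _ hCC, Fintype.card_fin]
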